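/- Let Ψ : ℝ → ℂ be continuous with Ψ(−ξ) = conjugate(Ψ(ξ)) for all ξ ∈ ℝ, and suppose that Ψ extends to a Rogers function. Then there exist α ≥ 0, β ∈ ℝ, γ ≥ 0 and a measurable function ν : ℝ∖{0} → [0,∞) with ∫_{ℝ∖{0}} min{1, x²} ν(x) dx < ∞, such that x ↦ ν(x) and x ↦ ν(−x) are completely monotone on (0,∞), and such that for every ξ ∈ ℝ, Ψ(ξ) = αξ² − iβξ + γ + ∫_{ℝ∖{0}} (1 − e^{iξx} + iξ(1 − e^{−|x|})·sign x) ν(x) dx. -/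

import Mathlib

open MeasureTheory Filter Set
open scoped ENNReal Topology

noncomputable section

/-- A *Rogers function*: holomorphic on the right half-plane, with `Re (F z / z) ≥ 0` there. -/
def IsRogersFunction (F : ℂ → ℂ) : Prop :=
  DifferentiableOn ℂ F {z : ℂ | 0 < z.re} ∧ ∀ z : ℂ, 0 < z.re → 0 ≤ (F z / z).re

/-- `Ψ` extends to a Rogers function: some Rogers function agrees with `Ψ` on `(0, ∞)`. -/
def ExtendsToRogersFunction (Ψ : ℝ → ℂ) : Prop :=
  ∃ F : ℂ → ℂ, IsRogersFunction F ∧ ∀ ξ : ℝ, 0 < ξ → F (ξ : ℂ) = Ψ ξ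

/-- `f` is completely monotone on `(0, ∞)`. -/
def CompletelyMonotoneOn (f : ℝ → ℝ) : Prop :=
  (∀ n : ℕ, ContDiffOn ℝ n f (Set.Ioi 0)) ∧
  ∀ (n : ℕ) (x : ℝ), 0 < x → 0 ≤ (-1 : ℝ) ^ n * iteratedDerivWithin n f (Set.Ioi 0) x

/-- **Schwarz integral formula**: a holomorphic function on a disc is recovered, up to an imaginary
constant, from the boundary values of its real part. -/
theorem DiffContOnCl.circleAverage_herglotzRieszKernel_mul_re {f : ℂ → ℂ} {R : ℝ} {w : ℂ}
    (hf : DiffContOnCl ℂ f (Metric.ball 0 R)) (hw : w ∈ Metric.ball 0 R) :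
    Real.circleAverage (fun ζ => herglotzRieszKernel 0 w ζ * ((f ζ).re : ℂ)) 0 R
      = f w - Complex.I * ((f 0).im : ℂ) := by
  have hR : 0 < R := Metric.pos_of_mem_ball hw
  have hwR : ‖w‖ < R := by simpa using hw
  have hcont : ContinuousOn f (Metric.sphere 0 R) :=
    hf.continuousOn.mono (by
      rw [closure_ball 0 hR.ne']; exact Metric.sphere_subset_closedBall)
  have hne : ∀ ζ ∈ Metric.sphere (0 : ℂ) R, ζ - w ≠ 0 := by
    intro ζ hζ h
    have : ‖ζ‖ = R := by simpa using hζ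
    rw [sub_eq_zero.1 h] at this
    exact hwR.ne this
  have hne' : ∀ ζ ∈ Metric.closedBall (0 : ℂ) R, (R : ℂ) ^ 2 - starRingEnd ℂ w * ζ ≠ 0 := by
    intro ζ hζ h
    have h1 : ‖ζ‖ ≤ R := by simpa using hζ
    have h2 : ‖(R : ℂ) ^ 2‖ = ‖w‖ * ‖ζ‖ := by rw [sub_eq_zero.1 h]; simp
    simp only [norm_pow, Complex.norm_real, Real.norm_eq_abs, sq_abs] at h2
    nlinarith [norm_nonneg w, norm_nonneg ζ]
  have hf' : DiffContOnCl ℂ f (Metric.ball 0 |R|) := by rwa [abs_of_pos hR]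
  have hw' : w ∈ Metric.ball 0 |R| := by rwa [abs_of_pos hR]
  have h1 : Real.circleAverage (fun ζ => (ζ / (ζ - w)) * f ζ) 0 R = f w := by
    simpa using hf'.circleAverage_smul_div hw'
  have h2 : Real.circleAverage
      (fun ζ => (R : ℂ) ^ 2 / ((R : ℂ) ^ 2 - starRingEnd ℂ w * ζ) * f ζ) 0 R = f 0 := by
    have hd : DiffContOnCl ℂ
        (fun ζ => ((R : ℂ) ^ 2 / ((R : ℂ) ^ 2 - starRingEnd ℂ w * ζ)) • f ζ)
        (Metric.ball 0 |R|) := by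
      rw [abs_of_pos hR]
      refine DiffContOnCl.smul ?_ hf
      refine DifferentiableOn.diffContOnCl ?_
      rw [closure_ball 0 hR.ne']
      exact DifferentiableOn.div (by fun_prop) (by fun_prop) hne'
    have := hd.circleAverage
    simpa [hR.ne'] using this
  have h3 : Real.circleAverage (fun ζ => (ζ / (ζ - w)) * starRingEnd ℂ (f ζ)) 0 R
      = starRingEnd ℂ (f 0) := by
    have hi : CircleIntegrable
        (fun ζ => (R : ℂ) ^ 2 / ((R : ℂ) ^ 2 - starRingEnd ℂ w * ζ) * f ζ) 0 R := by
      refine ContinuousOn.circleIntegrable hR.le (ContinuousOn.mul ?_ hcont)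
      exact ContinuousOn.div (by fun_prop) (by fun_prop)
        fun ζ hζ => hne' ζ (Metric.sphere_subset_closedBall hζ)
    have h4 := Complex.conjCLE.toContinuousLinearMap.circleAverage_comp_comm hi
    rw [h2] at h4
    refine Eq.trans (Real.circleAverage_congr_sphere ?_) h4
    intro ζ hζ
    rw [abs_of_pos hR] at hζ
    have hζR : ζ * starRingEnd ℂ ζ = (R : ℂ) ^ 2 := by
      rw [Complex.mul_conj, Complex.normSq_eq_norm_sq, mem_sphere_zero_iff_norm.1 hζ]
      push_cast; rfl
    have hn1 := hne ζ hζ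
    have hn2 := hne' ζ (Metric.sphere_subset_closedBall hζ)
    have hn3 : (R : ℂ) ^ 2 - w * starRingEnd ℂ ζ ≠ 0 := by
      intro h
      apply hn2
      have := congrArg (starRingEnd ℂ) h
      simpa using this
    simp only [Function.comp_apply, ContinuousLinearEquiv.coe_coe, Complex.conjCLE_apply,
      map_mul, map_div₀, map_sub, map_pow, Complex.conj_conj, Complex.conj_ofReal]
    congr 1
    rw [div_eq_div_iff hn1 hn3, ← hζR]
    ring
  have hi1 : CircleIntegrable (fun ζ => (ζ / (ζ - w)) * f ζ) 0 R :=
    ContinuousOn.circleIntegrable hR.le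
      ((ContinuousOn.div (by fun_prop) (by fun_prop) hne).mul hcont)
  have hi2 : CircleIntegrable (fun ζ => (ζ / (ζ - w)) * starRingEnd ℂ (f ζ)) 0 R :=
    ContinuousOn.circleIntegrable hR.le
      ((ContinuousOn.div (by fun_prop) (by fun_prop) hne).mul
        (Complex.continuous_conj.comp_continuousOn hcont))
  have hi3 : CircleIntegrable (fun ζ => ((f ζ).re : ℂ)) 0 R :=
    ContinuousOn.circleIntegrable hR.le (by fun_prop)
  have h5 : Real.circleAverage (fun ζ => ((f ζ).re : ℂ)) 0 R = ((f 0).re : ℂ) := by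
    have h := (Complex.ofRealCLM ∘L Complex.reCLM).circleAverage_comp_comm
      (hcont.circleIntegrable hR.le)
    rw [hf'.circleAverage] at h
    exact h
  have h6 : Real.circleAverage (fun ζ => herglotzRieszKernel 0 w ζ * ((f ζ).re : ℂ)) 0 R
      = Real.circleAverage (fun ζ => (ζ / (ζ - w)) * f ζ + (ζ / (ζ - w)) * starRingEnd ℂ (f ζ)
        - ((f ζ).re : ℂ)) 0 R := by
    refine Real.circleAverage_congr_sphere ?_
    intro ζ hζ
    rw [abs_of_pos hR] at hζ
    have hn1 := hne ζ hζ
    have hre : ((f ζ).re : ℂ) = (f ζ + starRingEnd ℂ (f ζ)) / 2 := by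
      rw [Complex.add_conj]; push_cast; ring
    simp only [herglotzRieszKernel_def, sub_zero]
    rw [hre]
    field_simp
    ring
  have hi12 : CircleIntegrable
      (fun ζ => (ζ / (ζ - w)) * f ζ + (ζ / (ζ - w)) * starRingEnd ℂ (f ζ)) 0 R := hi1.add hi2
  rw [h6, Real.circleAverage_fun_sub hi12 hi3, Real.circleAverage_fun_add hi1 hi2, h1, h3, h5]
  apply Complex.ext <;> simp [sub_eq_add_neg]

theorem circleMap_sub_ne_zero {w : ℂ} (hw : ‖w‖ < 1) (θ : ℝ) : circleMap 0 1 θ - w ≠ 0 := by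
  intro h
  have : ‖circleMap (0 : ℂ) 1 θ‖ = 1 := by simp
  rw [sub_eq_zero.1 h] at this
  exact hw.ne this

theorem continuous_herglotzRieszKernel_circleMap {w : ℂ} (hw : ‖w‖ < 1) :
    Continuous fun θ : ℝ => herglotzRieszKernel 0 w (circleMap 0 1 θ) := by
  simp only [herglotzRieszKernel_def, sub_zero]
  exact Continuous.div (by fun_prop) (by fun_prop) (circleMap_sub_ne_zero hw)

theorem norm_herglotzRieszKernel_circleMap_le {w : ℂ} (hw : ‖w‖ < 1) (θ : ℝ) :
    ‖herglotzRieszKernel 0 w (circleMap 0 1 θ)‖ ≤ 2 / (1 - ‖w‖) := by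
  have hc : ‖circleMap (0 : ℂ) 1 θ‖ = 1 := by simp
  simp only [herglotzRieszKernel_def, sub_zero, norm_div]
  have h1 : ‖circleMap 0 1 θ + w‖ ≤ 2 := (norm_add_le _ _).trans (by rw [hc]; linarith)
  have h2 : 1 - ‖w‖ ≤ ‖circleMap 0 1 θ - w‖ := by
    have := norm_sub_norm_le (circleMap 0 1 θ) w
    rwa [hc] at this
  have h3 : 0 < 1 - ‖w‖ := by linarith
  gcongr

/-- The Herglotz representation of a function with nonnegative real part that is holomorphic in the
unit disc and continuous up to the boundary. -/
theorem DiffContOnCl.exists_finiteMeasure_herglotz {f : ℂ → ℂ}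
    (hf : DiffContOnCl ℂ f (Metric.ball 0 1))
    (hpos : ∀ ζ ∈ Metric.closedBall (0 : ℂ) 1, 0 ≤ (f ζ).re) :
    ∃ μ : FiniteMeasure ℝ, μ.mass ≤ Real.toNNReal (f 0).re ∧ μ (Icc 0 (2 * Real.pi))ᶜ = 0 ∧
      ∀ w ∈ Metric.ball (0 : ℂ) 1,
        ∫ θ, herglotzRieszKernel 0 w (circleMap 0 1 θ) ∂(μ : Measure ℝ)
          = f w - Complex.I * ((f 0).im : ℂ) := by
  have hcont : ContinuousOn f (Metric.closedBall 0 1) := by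
    have := hf.continuousOn
    rwa [closure_ball 0 one_ne_zero] at this
  have hmaps : ∀ θ, circleMap (0 : ℂ) 1 θ ∈ Metric.closedBall (0 : ℂ) 1 :=
    fun θ => circleMap_mem_closedBall 0 zero_le_one θ
  set u : ℝ → ℝ := fun θ => (2 * Real.pi)⁻¹ * (f (circleMap 0 1 θ)).re with hu
  have hucont : Continuous u := by
    have : Continuous fun θ => f (circleMap 0 1 θ) :=
      hcont.comp_continuous (continuous_circleMap 0 1) hmaps
    exact (Complex.continuous_re.comp this).const_mul _
  have hunn : ∀ θ, 0 ≤ u θ := fun θ =>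
    mul_nonneg (by positivity) (hpos _ (hmaps θ))
  have huint : Integrable u (volume.restrict (Ioc 0 (2 * Real.pi))) :=
    (hucont.integrableOn_Icc (a := 0) (b := 2 * Real.pi)).mono_set Ioc_subset_Icc_self
  have hmass : ∫ θ in Ioc 0 (2 * Real.pi), u θ = (f 0).re := by
    have h1 := Complex.reCLM.circleAverage_comp_comm (f := f) (c := 0) (R := 1)
      ((hcont.mono Metric.sphere_subset_closedBall).circleIntegrable zero_le_one)
    rw [DiffContOnCl.circleAverage (by simpa using hf)] at h1
    rw [← Complex.reCLM_apply, ← h1, Real.circleAverage_def,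
      intervalIntegral.integral_of_le (by positivity), hu, integral_const_mul]
    rfl
  set m : Measure ℝ := (volume.restrict (Ioc 0 (2 * Real.pi))).withDensity
    (fun θ => ENNReal.ofReal (u θ)) with hm
  have hmuniv : m univ = ENNReal.ofReal (f 0).re := by
    rw [hm, withDensity_apply _ MeasurableSet.univ, Measure.restrict_univ,
      ← ofReal_integral_eq_lintegral_ofReal huint (Eventually.of_forall hunn), hmass]
  have hfin : IsFiniteMeasure m := ⟨by rw [hmuniv]; exact ENNReal.ofReal_lt_top⟩
  let M : FiniteMeasure ℝ := ⟨m, hfin⟩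
  refine ⟨M, ?_, ?_, ?_⟩
  · rw [← ENNReal.coe_le_coe, FiniteMeasure.ennreal_mass]
    exact hmuniv.le
  · rw [← ENNReal.coe_eq_zero, FiniteMeasure.ennreal_coeFn_eq_coeFn_toMeasure]
    refine withDensity_absolutelyContinuous _ _ ?_
    rw [Measure.restrict_apply measurableSet_Icc.compl]
    refine measure_mono_null (t := ∅) ?_ measure_empty
    rintro x ⟨h1, h2⟩
    exact h1 (Ioc_subset_Icc_self h2)
  · intro w hw
    rw [← hf.circleAverage_herglotzRieszKernel_mul_re hw, Real.circleAverage_def,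
      intervalIntegral.integral_of_le (by positivity), ← integral_smul]
    change ∫ θ, _ ∂m = _
    rw [hm, integral_withDensity_eq_integral_toReal_smul (by fun_prop) (by simp)]
    refine integral_congr_ae (Eventually.of_forall fun θ => ?_)
    beta_reduce
    rw [ENNReal.toReal_ofReal (hunn θ)]
    simp only [hu, Complex.real_smul]
    push_cast
    ring

/-- **Herglotz representation**: a holomorphic function on the unit disc with nonnegative real part
is, up to an imaginary constant, the Herglotz integral of a finite measure on the circle, here
parametrized by the angle. -/
theorem exists_isFiniteMeasure_herglotz {f : ℂ → ℂ}
    (hf : DifferentiableOn ℂ f (Metric.ball 0 1))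
    (hpos : ∀ ζ ∈ Metric.ball (0 : ℂ) 1, 0 ≤ (f ζ).re) :
    ∃ μ : Measure ℝ, IsFiniteMeasure μ ∧ ∀ w ∈ Metric.ball (0 : ℂ) 1,
      f w = Complex.I * ((f 0).im : ℂ)
        + ∫ θ, herglotzRieszKernel 0 w (circleMap 0 1 θ) ∂μ := by
  set r : ℕ → ℝ := fun n => 1 - 1 / ((n : ℝ) + 1) with hr
  have hr0 : ∀ n, 0 ≤ r n := by
    intro n
    have : 1 / ((n : ℝ) + 1) ≤ 1 := by
      rw [div_le_one (by positivity)]; linarith [n.cast_nonneg (α := ℝ)]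
    simp only [hr]; linarith
  have hr1 : ∀ n, r n < 1 := by
    intro n
    have : 0 < 1 / ((n : ℝ) + 1) := by positivity
    simp only [hr]; linarith
  have hrlim : Tendsto r atTop (𝓝 1) := by
    simpa [hr] using (tendsto_one_div_add_atTop_nhds_zero_nat (𝕜 := ℝ)).const_sub 1
  have hmaps : ∀ n, MapsTo (fun ζ : ℂ => (r n : ℂ) * ζ) (Metric.closedBall 0 1)
      (Metric.ball 0 1) := by
    intro n ζ hζ
    have h1 : ‖ζ‖ ≤ 1 := by simpa using hζ
    rw [mem_ball_zero_iff, norm_mul, Complex.norm_real, Real.norm_of_nonneg (hr0 n)]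
    nlinarith [hr0 n, hr1 n]
  have hex : ∀ n, ∃ μ : FiniteMeasure ℝ, μ.mass ≤ Real.toNNReal (f 0).re ∧
      μ (Icc 0 (2 * Real.pi))ᶜ = 0 ∧ ∀ w ∈ Metric.ball (0 : ℂ) 1,
        ∫ θ, herglotzRieszKernel 0 w (circleMap 0 1 θ) ∂(μ : Measure ℝ)
          = f (r n * w) - Complex.I * ((f 0).im : ℂ) := by
    intro n
    have hd : DiffContOnCl ℂ (fun ζ => f (r n * ζ)) (Metric.ball 0 1) := by
      refine DifferentiableOn.diffContOnCl ?_
      rw [closure_ball 0 one_ne_zero]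
      exact hf.comp (by fun_prop) (hmaps n)
    simpa using hd.exists_finiteMeasure_herglotz fun ζ hζ => hpos _ (hmaps n hζ)
  choose μ hμ1 hμ2 hμ3 using hex
  have hK := isCompact_setOfPred_finiteMeasure_le_of_isCompact (Real.toNNReal (f 0).re)
    (isCompact_Icc (a := (0 : ℝ)) (b := 2 * Real.pi))
  let U : Ultrafilter ℕ := Ultrafilter.of atTop
  obtain ⟨ν, -, hν⟩ := hK.ultrafilter_le_nhds (U.map μ) (by
    rw [Ultrafilter.coe_map, le_principal_iff, mem_map]
    exact Eventually.of_forall fun n => ⟨hμ1 n, hμ2 n⟩)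
  refine ⟨ν, inferInstance, fun w hw => ?_⟩
  have hw1 : ‖w‖ < 1 := by simpa using hw
  have hlim1 : Tendsto (fun n => ∫ θ, herglotzRieszKernel 0 w (circleMap 0 1 θ)
      ∂(μ n : Measure ℝ)) U
      (𝓝 (∫ θ, herglotzRieszKernel 0 w (circleMap 0 1 θ) ∂(ν : Measure ℝ))) :=
    (FiniteMeasure.tendsto_iff_forall_integral_rclike_tendsto ℂ).1 hν
      (BoundedContinuousFunction.ofNormedAddCommGroup _
        (continuous_herglotzRieszKernel_circleMap hw1) _ (norm_herglotzRieszKernel_circleMap_le hw1))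
  have hlim2 : Tendsto (fun n => f (r n * w) - Complex.I * ((f 0).im : ℂ)) U
      (𝓝 (f w - Complex.I * ((f 0).im : ℂ))) := by
    refine Tendsto.sub_const (Tendsto.mono_left ?_ (Ultrafilter.of_le atTop)) _
    have hcw : ContinuousAt f w :=
      (hf.differentiableAt (Metric.isOpen_ball.mem_nhds hw)).continuousAt
    refine hcw.tendsto.comp ?_
    have : Tendsto (fun n => (r n : ℂ)) atTop (𝓝 ((1 : ℝ) : ℂ)) :=
      (Complex.continuous_ofReal.tendsto 1).comp hrlim
    simpa using this.mul_const w
  simp only [fun n => hμ3 n w hw] at hlim1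
  rw [tendsto_nhds_unique hlim1 hlim2]
  ring

/-- **Nevanlinna representation** in the right half-plane: a holomorphic function with nonnegative
real part is determined by an imaginary constant, a nonnegative slope and a finite measure on the
line. -/
theorem exists_isFiniteMeasure_nevanlinna {G : ℂ → ℂ}
    (hG : DifferentiableOn ℂ G {z : ℂ | 0 < z.re}) (hpos : ∀ z : ℂ, 0 < z.re → 0 ≤ (G z).re) :
    ∃ (b c : ℝ) (μ : Measure ℝ), 0 ≤ c ∧ IsFiniteMeasure μ ∧ ∀ z : ℂ, 0 < z.re →
      G z = Complex.I * b + c * z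
        + ∫ s : ℝ, (1 + Complex.I * s * z) / (z + Complex.I * s) ∂μ := by
  have hcayley : ∀ w ∈ Metric.ball (0 : ℂ) 1, 1 - w ≠ 0 ∧ 0 < ((1 + w) / (1 - w)).re := by
    intro w hw
    have hw1 : ‖w‖ < 1 := by simpa using hw
    have hne : 1 - w ≠ 0 := by
      intro h
      rw [← sub_eq_zero.1 h, norm_one] at hw1
      exact lt_irrefl _ hw1
    refine ⟨hne, ?_⟩
    have h1 : 0 < Complex.normSq (1 - w) := Complex.normSq_pos.2 hne
    have h2 : w.re * w.re + w.im * w.im < 1 := by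
      rw [← Complex.normSq_apply, Complex.normSq_eq_norm_sq]
      nlinarith [norm_nonneg w]
    rw [Complex.div_re, ← add_div]
    refine div_pos ?_ h1
    simp only [Complex.add_re, Complex.sub_re, Complex.add_im, Complex.sub_im, Complex.one_re,
      Complex.one_im]
    nlinarith
  have hH : DifferentiableOn ℂ (fun w => G ((1 + w) / (1 - w))) (Metric.ball 0 1) := by
    refine hG.comp (DifferentiableOn.div (by fun_prop) (by fun_prop) fun w hw => (hcayley w hw).1)
      fun w hw => (hcayley w hw).2
  obtain ⟨μ, hμfin, hμ⟩ := exists_isFiniteMeasure_herglotz hH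
    fun w hw => hpos _ (hcayley w hw).2
  set A : Set ℝ := {θ | circleMap 0 1 θ = 1} with hA
  have hAmeas : MeasurableSet A := by
    have : IsClosed A := isClosed_eq (continuous_circleMap 0 1) continuous_const
    exact this.measurableSet
  set s : ℝ → ℝ := fun θ =>
    (Complex.I * ((1 + circleMap 0 1 θ) / (1 - circleMap 0 1 θ))).re with hs
  have hsmeas : Measurable s := by fun_prop
  refine ⟨(G 1).im, μ.real A, (μ.restrict Aᶜ).map s, measureReal_nonneg,
    inferInstance, fun z hz => ?_⟩
  have hz1 : z + 1 ≠ 0 := by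
    intro h
    have := congrArg Complex.re h
    simp at this
    linarith
  set w : ℂ := (z - 1) / (z + 1) with hw
  have hwball : w ∈ Metric.ball (0 : ℂ) 1 := by
    rw [mem_ball_zero_iff, hw, norm_div, div_lt_one (norm_pos_iff.2 hz1),
      ← sq_lt_sq₀ (norm_nonneg _) (norm_nonneg _), ← Complex.normSq_eq_norm_sq,
      ← Complex.normSq_eq_norm_sq, Complex.normSq_apply, Complex.normSq_apply]
    simp
    nlinarith
  have hwz : (1 + w) / (1 - w) = z := by
    have h2 : (1 - w) = 2 / (z + 1) := by rw [hw]; field_simp; ring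
    have h3 : (1 + w) = 2 * z / (z + 1) := by rw [hw]; field_simp; ring
    rw [h2, h3]
    field_simp
  have hwne := (hcayley w hwball).1
  have hw1 : ‖w‖ < 1 := by simpa using hwball
  have hkint : Integrable (fun θ : ℝ => herglotzRieszKernel 0 w (circleMap 0 1 θ)) μ :=
    Integrable.of_bound (continuous_herglotzRieszKernel_circleMap hw1).aestronglyMeasurable
      (2 / (1 - ‖w‖)) (Eventually.of_forall (norm_herglotzRieszKernel_circleMap_le hw1))
  have hmain := hμ w hwball
  rw [hwz, ← integral_add_compl hAmeas hkint] at hmain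
  have h0 : (1 + (0 : ℂ)) / (1 - 0) = 1 := by norm_num
  rw [h0] at hmain
  have hI1 : ∫ θ in A, herglotzRieszKernel 0 w (circleMap 0 1 θ) ∂μ = μ.real A * z := by
    rw [setIntegral_congr_fun (g := fun _ => z) hAmeas, setIntegral_const, Complex.real_smul]
    intro θ hθ
    have : circleMap 0 1 θ = 1 := hθ
    simp only [herglotzRieszKernel_def, sub_zero, this, hwz]
  have hI2 : ∫ θ in Aᶜ, herglotzRieszKernel 0 w (circleMap 0 1 θ) ∂μ
      = ∫ t : ℝ, (1 + Complex.I * t * z) / (z + Complex.I * t) ∂((μ.restrict Aᶜ).map s) := by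
    rw [integral_map hsmeas.aemeasurable (by
      exact Measurable.aestronglyMeasurable (by fun_prop))]
    refine setIntegral_congr_fun hAmeas.compl fun θ hθ => ?_
    have hζne : 1 - circleMap 0 1 θ ≠ 0 := fun h => hθ (sub_eq_zero.1 h).symm
    have hζ : circleMap 0 1 θ * starRingEnd ℂ (circleMap 0 1 θ) = 1 := by
      rw [Complex.mul_conj, Complex.normSq_eq_norm_sq]; simp
    have hk := circleMap_sub_ne_zero hw1 θ
    simp only [hs]
    generalize circleMap 0 1 θ = ζ at *
    have hsI : (((Complex.I * ((1 + ζ) / (1 - ζ))).re : ℝ) : ℂ)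
        = Complex.I * ((1 + ζ) / (1 - ζ)) := by
      rw [← Complex.conj_eq_iff_re]
      have hζ0 : ζ ≠ 0 := by rintro rfl; simp at hζ
      have hc : starRingEnd ℂ ζ = 1 / ζ := by rw [eq_div_iff hζ0, mul_comm, hζ]
      have hζ1 : ζ - 1 ≠ 0 := by
        intro h; apply hζne; linear_combination -h
      simp only [map_mul, map_div₀, map_add, map_sub, map_one, Complex.conj_I, hc]
      have : 1 - 1 / ζ = (ζ - 1) / ζ := by field_simp
      rw [this]
      field_simp
      ring
    rw [hsI]
    simp only [herglotzRieszKernel_def, sub_zero]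
    have hq : Complex.I * (Complex.I * ((1 + ζ) / (1 - ζ))) = -((1 + ζ) / (1 - ζ)) := by
      rw [← mul_assoc, Complex.I_mul_I]; ring
    rw [hq]
    have hd : z + -((1 + ζ) / (1 - ζ)) = -(z + 1) * (ζ - w) / (1 - ζ) := by
      rw [hw]; field_simp; ring
    have hn : 1 + -((1 + ζ) / (1 - ζ)) * z = -(z + 1) * (ζ + w) / (1 - ζ) := by
      rw [hw]; field_simp; ring
    rw [hd, hn, div_div_div_cancel_right₀ hζne, mul_div_mul_left _ _ (neg_ne_zero.2 hz1)]
  rw [hmain, hI1, hI2, add_assoc]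

/-- The Laplace transform of a measure on `[0, ∞)` is completely monotone where it is finite. -/
theorem completelyMonotoneOn_mgf_neg {σ : Measure ℝ} (hσ : ∀ᵐ s ∂σ, 0 ≤ s)
    (hint : ∀ x : ℝ, 0 < x → Integrable (fun s : ℝ => Real.exp (x * -s)) σ) :
    CompletelyMonotoneOn (ProbabilityTheory.mgf (fun s : ℝ => -s) σ) := by
  have hsub : Ioi (0 : ℝ) ⊆ interior (ProbabilityTheory.integrableExpSet (fun s : ℝ => -s) σ) :=
    isOpen_Ioi.subset_interior_iff.2 fun x hx => hint x hx
  have han : AnalyticOnNhd ℝ (ProbabilityTheory.mgf (fun s : ℝ => -s) σ) (Ioi 0) :=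
    ProbabilityTheory.analyticOnNhd_mgf.mono hsub
  refine ⟨fun n => han.contDiffOn (uniqueDiffOn_Ioi 0), fun n x hx => ?_⟩
  rw [iteratedDerivWithin_of_isOpen isOpen_Ioi hx, ProbabilityTheory.iteratedDeriv_mgf (hsub hx),
    ← integral_const_mul]
  refine integral_nonneg_of_ae ?_
  filter_upwards [hσ] with s hs
  rw [← mul_assoc, ← mul_pow]
  simp only [neg_mul_neg, one_mul, Pi.zero_apply]
  positivity

theorem mul_add_cube_mul_exp_neg_le {x s : ℝ} (hx : 0 < x) (hs : 0 ≤ s) :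
    s * (1 + s ^ 2) * Real.exp (x * -s) ≤ 1 / x + 6 / x ^ 3 := by
  have hxs : 0 ≤ x * s := by positivity
  have h1 := Real.pow_div_factorial_le_exp (x * s) hxs 1
  have h3 := Real.pow_div_factorial_le_exp (x * s) hxs 3
  norm_num [Nat.factorial] at h1 h3
  have he : Real.exp (x * -s) = (Real.exp (x * s))⁻¹ := by rw [← Real.exp_neg]; congr 1; ring
  rw [he, ← div_eq_mul_inv, div_le_iff₀ (Real.exp_pos _)]
  have h1' : s ≤ 1 / x * Real.exp (x * s) := by
    rw [div_mul_eq_mul_div, le_div_iff₀ hx]; linarith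
  have h3' : s ^ 3 ≤ 6 / x ^ 3 * Real.exp (x * s) := by
    rw [div_mul_eq_mul_div, le_div_iff₀ (by positivity)]
    rw [mul_pow] at h3
    linarith
  linarith

theorem integrableOn_exp_mul_neg {s : ℝ} (hs : 0 < s) :
    IntegrableOn (fun x : ℝ => Real.exp (x * -s)) (Ioi 0) := by
  simpa only [mul_comm] using integrableOn_exp_mul_Ioi (neg_lt_zero.2 hs) 0

theorem integral_exp_mul_neg {s : ℝ} (hs : 0 < s) :
    ∫ x in Ioi (0 : ℝ), Real.exp (x * -s) = 1 / s := by
  have := integral_exp_mul_Ioi (neg_lt_zero.2 hs) 0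
  simpa [mul_comm] using this

theorem integrableOn_sq_mul_exp_mul_neg {s : ℝ} (hs : 0 < s) :
    IntegrableOn (fun x : ℝ => x ^ 2 * Real.exp (x * -s)) (Ioi 0) := by
  have := integrableOn_rpow_mul_exp_neg_mul_rpow (p := 1) (s := 2) (b := s) (by norm_num)
    one_pos hs
  refine this.congr_fun (fun x _ => ?_) measurableSet_Ioi
  simp only [Real.rpow_one, Real.rpow_two]
  congr 2
  ring

theorem integral_sq_mul_exp_mul_neg {s : ℝ} (hs : 0 < s) :
    ∫ x in Ioi (0 : ℝ), x ^ 2 * Real.exp (x * -s) = 2 / s ^ 3 := by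
  have h := Real.integral_rpow_mul_exp_neg_mul_Ioi (a := 3) (r := s) (by norm_num) hs
  have hG : Real.Gamma 3 = 2 := by
    rw [show (3 : ℝ) = ((2 : ℕ) : ℝ) + 1 by norm_num, Real.Gamma_nat_eq_factorial]
    norm_num [Nat.factorial]
  have hp : (1 / s) ^ (3 : ℝ) = 1 / s ^ 3 := by
    rw [show (3 : ℝ) = ((3 : ℕ) : ℝ) by norm_num, Real.rpow_natCast, one_div_pow]
  rw [hG, hp] at h
  rw [show 2 / s ^ 3 = 1 / s ^ 3 * 2 by ring, ← h]
  refine setIntegral_congr_fun measurableSet_Ioi fun x _ => ?_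
  have : (3 : ℝ) - 1 = 2 := by norm_num
  simp only [this, Real.rpow_two]
  congr 2
  ring

theorem integral_norm_mul_exp_mul_neg_le {K : ℝ → ℂ} {C s : ℝ} (hs : 0 < s) (hC : 0 ≤ C)
    (hK : ∀ x : ℝ, 0 < x → ‖K x‖ ≤ C * min 1 (x ^ 2)) :
    ∫ x in Ioi (0 : ℝ), ‖K x * (Real.exp (x * -s) : ℂ)‖ ≤ 3 * C * (1 / (s * (1 + s ^ 2))) := by
  have hnorm : ∀ x : ℝ, ‖K x * (Real.exp (x * -s) : ℂ)‖ = ‖K x‖ * Real.exp (x * -s) := by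
    intro x
    rw [norm_mul, Complex.norm_real, Real.norm_of_nonneg (Real.exp_pos _).le]
  have h1 : ∫ x in Ioi (0 : ℝ), ‖K x * (Real.exp (x * -s) : ℂ)‖ ≤ C * (1 / s) := by
    rw [← integral_exp_mul_neg hs, ← integral_const_mul]
    refine integral_mono_of_nonneg (Eventually.of_forall fun x => norm_nonneg _)
      ((integrableOn_exp_mul_neg hs).const_mul C) ?_
    filter_upwards [self_mem_ae_restrict measurableSet_Ioi] with x hx
    rw [hnorm]
    gcongr
    exact (hK x hx).trans (mul_le_of_le_one_right hC (min_le_left _ _))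
  have h2 : ∫ x in Ioi (0 : ℝ), ‖K x * (Real.exp (x * -s) : ℂ)‖ ≤ C * (2 / s ^ 3) := by
    rw [← integral_sq_mul_exp_mul_neg hs, ← integral_const_mul]
    refine integral_mono_of_nonneg (Eventually.of_forall fun x => norm_nonneg _)
      ((integrableOn_sq_mul_exp_mul_neg hs).const_mul C) ?_
    filter_upwards [self_mem_ae_restrict measurableSet_Ioi] with x hx
    rw [hnorm, ← mul_assoc]
    gcongr
    exact (hK x hx).trans (by gcongr; exact min_le_right _ _)
  rw [mul_one_div, le_div_iff₀ (by positivity)]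
  rw [mul_one_div, le_div_iff₀ hs] at h1
  rw [mul_div_assoc', le_div_iff₀ (by positivity)] at h2
  linarith

theorem integrable_exp_mul_neg {σ : Measure ℝ} (hσ : ∀ᵐ s ∂σ, 0 < s)
    (hint : Integrable (fun s : ℝ => 1 / (s * (1 + s ^ 2))) σ) {x : ℝ} (hx : 0 < x) :
    Integrable (fun s : ℝ => Real.exp (x * -s)) σ := by
  refine (hint.const_mul (1 / x + 6 / x ^ 3)).mono' (by fun_prop) ?_
  filter_upwards [hσ] with s hs
  rw [Real.norm_of_nonneg (Real.exp_pos _).le, mul_one_div, le_div_iff₀ (by positivity), mul_comm]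
  exact mul_add_cube_mul_exp_neg_le hx hs.le

theorem integrable_prod_mul_exp_mul_neg {σ : Measure ℝ} [SFinite σ] (hσ : ∀ᵐ s ∂σ, 0 < s)
    (hint : Integrable (fun s : ℝ => 1 / (s * (1 + s ^ 2))) σ) {K : ℝ → ℂ} {C : ℝ}
    (hKm : Measurable K) (hC : 0 ≤ C) (hK : ∀ x : ℝ, 0 < x → ‖K x‖ ≤ C * min 1 (x ^ 2)) :
    Integrable (Function.uncurry fun x s : ℝ => K x * (Real.exp (x * -s) : ℂ))
      ((volume.restrict (Ioi 0)).prod σ) := by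
  have hm : StronglyMeasurable (Function.uncurry fun x s : ℝ => K x * (Real.exp (x * -s) : ℂ)) := by
    refine Measurable.stronglyMeasurable ?_
    simp only [Function.uncurry_def]
    fun_prop
  rw [integrable_prod_iff' hm.aestronglyMeasurable]
  constructor
  · filter_upwards [hσ] with s hs
    refine ((integrableOn_exp_mul_neg hs).const_mul C).mono' (by
      exact Measurable.aestronglyMeasurable (by fun_prop)) ?_
    filter_upwards [self_mem_ae_restrict measurableSet_Ioi] with x hx
    rw [Function.uncurry_apply_pair, norm_mul, Complex.norm_real,
      Real.norm_of_nonneg (Real.exp_pos _).le]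
    gcongr
    exact (hK x hx).trans (mul_le_of_le_one_right hC (min_le_left _ _))
  · refine (hint.const_mul (3 * C)).mono' ?_ ?_
    · exact (hm.norm.integral_prod_left' (μ := volume.restrict (Ioi (0 : ℝ)))).aestronglyMeasurable
    · filter_upwards [hσ] with s hs
      rw [Real.norm_of_nonneg (integral_nonneg fun x => norm_nonneg _)]
      exact integral_norm_mul_exp_mul_neg_le hs hC hK

theorem integrableOn_mul_mgf_neg {σ : Measure ℝ} [SFinite σ] (hσ : ∀ᵐ s ∂σ, 0 < s)
    (hint : Integrable (fun s : ℝ => 1 / (s * (1 + s ^ 2))) σ) {K : ℝ → ℂ} {C : ℝ}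
    (hKm : Measurable K) (hC : 0 ≤ C) (hK : ∀ x : ℝ, 0 < x → ‖K x‖ ≤ C * min 1 (x ^ 2)) :
    IntegrableOn (fun x => K x * (ProbabilityTheory.mgf (fun s : ℝ => -s) σ x : ℂ)) (Ioi 0) := by
  have h := (integrable_prod_mul_exp_mul_neg hσ hint hKm hC hK).integral_prod_left
  refine h.congr (Eventually.of_forall fun x => ?_)
  simp only [Function.uncurry_apply_pair]
  rw [integral_const_mul, integral_complex_ofReal]
  rfl

theorem integral_mul_mgf_neg {σ : Measure ℝ} [SFinite σ] (hσ : ∀ᵐ s ∂σ, 0 < s)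
    (hint : Integrable (fun s : ℝ => 1 / (s * (1 + s ^ 2))) σ) {K : ℝ → ℂ} {C : ℝ}
    (hKm : Measurable K) (hC : 0 ≤ C) (hK : ∀ x : ℝ, 0 < x → ‖K x‖ ≤ C * min 1 (x ^ 2)) :
    ∫ x in Ioi (0 : ℝ), K x * (ProbabilityTheory.mgf (fun s : ℝ => -s) σ x : ℂ)
      = ∫ s, (∫ x in Ioi (0 : ℝ), K x * (Real.exp (x * -s) : ℂ)) ∂σ := by
  rw [← integral_integral_swap (integrable_prod_mul_exp_mul_neg hσ hint hKm hC hK)]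
  refine integral_congr_ae (Eventually.of_forall fun x => ?_)
  beta_reduce
  rw [integral_const_mul, integral_complex_ofReal]
  rfl

/-- The compensated kernel of the Lévy–Khintchine formula on the positive half-line. -/
def levyKernel (ξ x : ℝ) : ℂ :=
  1 - Complex.exp (Complex.I * ξ * x) + Complex.I * ξ * ((1 - Real.exp (-x) : ℝ) : ℂ)

theorem measurable_levyKernel (ξ : ℝ) : Measurable (levyKernel ξ) := by
  unfold levyKernel
  fun_prop

theorem Complex.norm_exp_I_mul_sub_one_sub_le (t : ℝ) :
    ‖Complex.exp (Complex.I * t) - 1 - Complex.I * t‖ ≤ 3 * t ^ 2 := by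
  have hn : ‖Complex.I * (t : ℂ)‖ = |t| := by simp
  rcases le_or_gt |t| 1 with h | h
  · have h1 := Complex.norm_exp_sub_one_sub_id_le (x := Complex.I * t) (by rw [hn]; exact h)
    rw [hn, sq_abs] at h1
    nlinarith [sq_nonneg t]
  · have h1 : ‖Complex.exp (Complex.I * t)‖ = 1 := by
      rw [mul_comm]; exact Complex.norm_exp_ofReal_mul_I t
    have h2 := norm_sub_le (Complex.exp (Complex.I * t) - 1) (Complex.I * t)
    have h3 := norm_sub_le (Complex.exp (Complex.I * t)) 1
    rw [h1, norm_one] at h3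
    rw [hn] at h2
    have h4 : t ^ 2 = |t| ^ 2 := (sq_abs t).symm
    rw [h4]
    nlinarith

theorem norm_levyKernel_le (ξ : ℝ) {x : ℝ} (hx : 0 < x) :
    ‖levyKernel ξ x‖ ≤ (2 + |ξ| + 3 * ξ ^ 2) * min 1 (x ^ 2) := by
  have hexp : Real.exp (-x) ≤ 1 := Real.exp_le_one_iff.2 (by linarith)
  have hnI : ‖Complex.I * (ξ : ℂ)‖ = |ξ| := by simp
  rw [mul_min_of_nonneg _ _ (by positivity), le_min_iff]
  constructor
  · have h1 : ‖Complex.exp (Complex.I * ξ * x)‖ = 1 := by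
      rw [show Complex.I * (ξ : ℂ) * x = ((ξ * x : ℝ) : ℂ) * Complex.I by push_cast; ring]
      exact Complex.norm_exp_ofReal_mul_I _
    have h2 := norm_add_le (1 - Complex.exp (Complex.I * ξ * x))
      (Complex.I * ξ * ((1 - Real.exp (-x) : ℝ) : ℂ))
    have h3 := norm_sub_le 1 (Complex.exp (Complex.I * ξ * x))
    rw [h1, norm_one] at h3
    rw [norm_mul (Complex.I * (ξ : ℂ)), hnI, Complex.norm_real,
      Real.norm_of_nonneg (by linarith)] at h2
    have h4 : |ξ| * (1 - Real.exp (-x)) ≤ |ξ| :=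
      mul_le_of_le_one_right (abs_nonneg _) (by linarith [Real.exp_pos (-x)])
    unfold levyKernel
    nlinarith [sq_nonneg ξ]
  · have h1 := Complex.norm_exp_I_mul_sub_one_sub_le (ξ * x)
    have h2 : |1 - Real.exp (-x) - x| ≤ x ^ 2 := by
      have hl := Real.add_one_le_exp (-x)
      have hu : Real.exp (-x) ≤ 1 / (1 + x) := by
        rw [Real.exp_neg, inv_eq_one_div]
        exact one_div_le_one_div_of_le (by linarith) (by linarith [Real.add_one_le_exp x])
      have hu' : 1 / (1 + x) ≤ 1 - x + x ^ 2 := by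
        rw [div_le_iff₀ (by linarith)]
        nlinarith [pow_pos hx 3]
      rw [abs_le]
      constructor <;> nlinarith
    have h3 : levyKernel ξ x = -(Complex.exp (Complex.I * (ξ * x : ℝ)) - 1
        - Complex.I * (ξ * x : ℝ)) + Complex.I * ξ * ((1 - Real.exp (-x) - x : ℝ) : ℂ) := by
      unfold levyKernel
      push_cast
      ring_nf
    rw [h3]
    refine (norm_add_le _ _).trans ?_
    rw [norm_neg, norm_mul (Complex.I * (ξ : ℂ)), hnI, Complex.norm_real, Real.norm_eq_abs]
    have h4 := mul_le_mul_of_nonneg_left h2 (abs_nonneg ξ)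
    nlinarith [sq_nonneg x]

/-- The Laplace transform of the compensated Lévy kernel. -/
theorem integral_levyKernel_mul_exp (ξ : ℝ) {s : ℝ} (hs : 0 < s) :
    ∫ x in Ioi (0 : ℝ), levyKernel ξ x * (Real.exp (x * -s) : ℂ)
      = (ξ ^ 2 - Complex.I * ξ) / (s * (s + 1) * (s - Complex.I * ξ)) := by
  have ha1 : (-(s : ℂ)).re < 0 := by simpa using hs
  have ha2 : (Complex.I * ξ - s : ℂ).re < 0 := by simpa using hs
  have ha3 : (-((s : ℂ) + 1)).re < 0 := by simp; linarith
  have hs0 : (s : ℂ) ≠ 0 := by exact_mod_cast hs.ne'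
  have hs1 : (s : ℂ) + 1 ≠ 0 := by
    intro h
    rw [h] at ha3; simp at ha3
  have hs2 : (s : ℂ) - Complex.I * ξ ≠ 0 := by
    intro h
    have : (Complex.I * ξ - s : ℂ) = 0 := by linear_combination -h
    rw [this] at ha2; simp at ha2
  have hs3 : Complex.I * ξ - (s : ℂ) ≠ 0 := fun h => hs2 (by linear_combination -h)
  have hI1 := (integrableOn_exp_mul_complex_Ioi ha1 0).const_mul (1 + Complex.I * ξ)
  have hI2 := integrableOn_exp_mul_complex_Ioi ha2 0
  have hI3 := (integrableOn_exp_mul_complex_Ioi ha3 0).const_mul (Complex.I * ξ)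
  have hI12 : Integrable (fun x : ℝ => (1 + Complex.I * ξ) * Complex.exp (-(s : ℂ) * x)
      - Complex.exp ((Complex.I * ξ - s) * x)) (volume.restrict (Ioi 0)) := hI1.sub hI2
  have hcongr : ∀ x : ℝ, levyKernel ξ x * (Real.exp (x * -s) : ℂ)
      = (1 + Complex.I * ξ) * Complex.exp (-(s : ℂ) * x)
        - Complex.exp ((Complex.I * ξ - s) * x)
        - Complex.I * ξ * Complex.exp (-((s : ℂ) + 1) * x) := by
    intro x
    have e2 : Complex.exp ((Complex.I * ξ - s) * x)
        = Complex.exp (Complex.I * ξ * x) * Complex.exp (-(s : ℂ) * x) := by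
      rw [← Complex.exp_add]; ring_nf
    have e3 : Complex.exp (-((s : ℂ) + 1) * x)
        = Complex.exp (-(x : ℂ)) * Complex.exp (-(s : ℂ) * x) := by
      rw [← Complex.exp_add]; ring_nf
    have e1 : (Real.exp (x * -s) : ℂ) = Complex.exp (-(s : ℂ) * x) := by
      push_cast; ring_nf
    rw [e1, e2, e3]
    unfold levyKernel
    push_cast
    ring
  simp only [hcongr]
  rw [integral_sub hI12 hI3, integral_sub hI1 hI2, integral_const_mul, integral_const_mul,
    integral_exp_mul_complex_Ioi ha1, integral_exp_mul_complex_Ioi ha2,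
    integral_exp_mul_complex_Ioi ha3]
  simp only [Complex.ofReal_zero, mul_zero, Complex.exp_zero]
  have hs3' : Complex.I * ξ - (s : ℂ) = -(s - Complex.I * ξ) := by ring
  rw [hs3', neg_div_neg_eq, neg_div_neg_eq, neg_div_neg_eq]
  field_simp
  ring_nf
  rw [Complex.I_sq]
  ring

/-- The boundary kernel of the Nevanlinna representation, multiplied by the variable `ξ`. -/
def nevanlinnaKernel (ξ s : ℝ) : ℂ :=
  ξ * ((1 + Complex.I * s * ξ) / (ξ + Complex.I * s))

theorem measurable_nevanlinnaKernel (ξ : ℝ) : Measurable (nevanlinnaKernel ξ) := by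
  unfold nevanlinnaKernel
  fun_prop

theorem nevanlinnaKernel_neg_right (ξ s : ℝ) :
    nevanlinnaKernel ξ (-s) = nevanlinnaKernel (-ξ) s := by
  unfold nevanlinnaKernel
  push_cast
  have h : (-(ξ : ℂ) + Complex.I * s) = -(ξ + Complex.I * -s) := by ring
  rw [h, div_neg]
  ring

theorem norm_nevanlinnaKernel_le (ξ s : ℝ) : ‖nevanlinnaKernel ξ s‖ ≤ 1 + ξ ^ 2 := by
  unfold nevanlinnaKernel
  rcases eq_or_ne ξ 0 with rfl | hξ
  · simp
  have hpos : 0 < ξ ^ 2 + s ^ 2 := by positivity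
  have hd : ‖(ξ : ℂ) + Complex.I * s‖ ^ 2 = ξ ^ 2 + s ^ 2 := by
    rw [Complex.sq_norm, Complex.normSq_apply]
    simp
    ring
  have hn : ‖1 + Complex.I * s * ξ‖ ^ 2 = 1 + s ^ 2 * ξ ^ 2 := by
    rw [Complex.sq_norm, Complex.normSq_apply]
    simp
    ring
  refine (sq_le_sq₀ (norm_nonneg _) (by positivity)).1 ?_
  rw [norm_mul, norm_div, mul_pow, div_pow, hd, hn, Complex.norm_real, Real.norm_eq_abs, sq_abs,
    ← mul_div_assoc, div_le_iff₀ hpos]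
  nlinarith [sq_nonneg (ξ * s), sq_nonneg (ξ ^ 2), sq_nonneg (ξ ^ 2 * s), sq_nonneg (ξ ^ 3),
    sq_nonneg s, sq_nonneg ξ]

theorem integrable_nevanlinnaKernel (ρ : Measure ℝ) [IsFiniteMeasure ρ] (ξ : ℝ) :
    Integrable (nevanlinnaKernel ξ) ρ :=
  Integrable.of_bound (measurable_nevanlinnaKernel ξ).aestronglyMeasurable (1 + ξ ^ 2)
    (Eventually.of_forall fun s => norm_nevanlinnaKernel_le ξ s)

theorem nevanlinnaKernel_eq (ξ : ℝ) {s : ℝ} (hs : 0 < s) :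
    nevanlinnaKernel ξ s = ((s * (1 + s ^ 2) : ℝ) : ℂ)
        * ((ξ ^ 2 - Complex.I * ξ) / (s * (s + 1) * (s - Complex.I * ξ)))
      + Complex.I * ξ * (((s - 1) / (s + 1) : ℝ) : ℂ) := by
  have hs0 : (s : ℂ) ≠ 0 := by exact_mod_cast hs.ne'
  have hs1 : (s : ℂ) + 1 ≠ 0 := by exact_mod_cast (by positivity : s + 1 ≠ 0)
  have hs2 : (s : ℂ) - Complex.I * ξ ≠ 0 := by
    intro h
    simpa [hs.ne'] using congrArg Complex.re h
  have hs3 : (ξ : ℂ) + Complex.I * s = Complex.I * (s - Complex.I * ξ) := by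
    linear_combination (ξ : ℂ) * Complex.I_sq
  have hL : nevanlinnaKernel ξ s = (s * ξ ^ 2 - Complex.I * ξ) / (s - Complex.I * ξ) := by
    unfold nevanlinnaKernel
    rw [hs3, ← mul_div_assoc, div_eq_div_iff (mul_ne_zero Complex.I_ne_zero hs2) hs2]
    linear_combination (s - Complex.I * ξ) * ξ * Complex.I_sq
  have hR : ((s * (1 + s ^ 2) : ℝ) : ℂ)
      * ((ξ ^ 2 - Complex.I * ξ) / (s * (s + 1) * (s - Complex.I * ξ)))
      = (1 + s ^ 2) * (ξ ^ 2 - Complex.I * ξ) / ((s + 1) * (s - Complex.I * ξ)) := by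
    push_cast
    rw [← mul_div_assoc, mul_assoc (s : ℂ), mul_assoc (s : ℂ), mul_div_mul_left _ _ hs0]
  rw [hL, hR]
  push_cast
  rw [← mul_div_assoc, div_add_div _ _ (mul_ne_zero hs1 hs2) hs1,
    div_eq_div_iff hs2 (mul_ne_zero (mul_ne_zero hs1 hs2) hs1)]
  linear_combination (s - Complex.I * ξ) * (s - 1) * ξ ^ 2 * (s + 1) * Complex.I_sq

/-- Every finite measure on `(0, ∞)` gives rise to a completely monotone Lévy density on
`(0, ∞)` whose compensated exponent is the corresponding Nevanlinna integral. -/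
theorem exists_completelyMonotoneOn_levyDensity {ρ : Measure ℝ} [IsFiniteMeasure ρ]
    (hρ : ∀ᵐ s ∂ρ, 0 < s) :
    ∃ N : ℝ → ℝ, Measurable N ∧ (∀ x, 0 ≤ N x) ∧ CompletelyMonotoneOn N ∧
      IntegrableOn (fun x => min 1 (x ^ 2) * N x) (Ioi 0) ∧
      ∀ ξ : ℝ, IntegrableOn (fun x => levyKernel ξ x * (N x : ℂ)) (Ioi 0) ∧
        ∫ x in Ioi (0 : ℝ), levyKernel ξ x * (N x : ℂ)
          = ∫ s, nevanlinnaKernel ξ s ∂ρ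
            - Complex.I * ξ * ((∫ s, (s - 1) / (s + 1) ∂ρ : ℝ) : ℂ) := by
  set w : ℝ → ℝ≥0∞ := fun s => ENNReal.ofReal (s * (1 + s ^ 2)) with hw
  have hwm : Measurable w := by fun_prop
  have hwlt : ∀ᵐ s ∂ρ, w s < ∞ := Eventually.of_forall fun s => ENNReal.ofReal_lt_top
  have hwr : ∀ s : ℝ, 0 < s → (w s).toReal = s * (1 + s ^ 2) := fun s hs =>
    ENNReal.toReal_ofReal (by positivity)
  set σ := ρ.withDensity w
  have hσ : ∀ᵐ s ∂σ, 0 < s := (withDensity_absolutelyContinuous ρ w).ae_le hρ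
  have hint : Integrable (fun s : ℝ => 1 / (s * (1 + s ^ 2))) σ := by
    rw [integrable_withDensity_iff_integrable_smul' hwm hwlt]
    refine (integrable_const (1 : ℝ)).congr ?_
    filter_upwards [hρ] with s hs
    rw [hwr s hs, smul_eq_mul]
    field_simp
  set N := ProbabilityTheory.mgf (fun s : ℝ => -s) σ with hN
  have hN0 : ∀ x, 0 ≤ N x := fun x => ProbabilityTheory.mgf_nonneg
  refine ⟨N, ?_, hN0, ?_, ?_, fun ξ => ⟨?_, ?_⟩⟩
  · have : StronglyMeasurable (Function.uncurry fun x s : ℝ => Real.exp (x * -s)) := by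
      refine Measurable.stronglyMeasurable ?_
      simp only [Function.uncurry_def]
      fun_prop
    exact this.integral_prod_right.measurable
  · exact completelyMonotoneOn_mgf_neg (hσ.mono fun s hs => hs.le)
      fun x hx => integrable_exp_mul_neg hσ hint hx
  · have h := integrableOn_mul_mgf_neg hσ hint (K := fun x => ((min 1 (x ^ 2) : ℝ) : ℂ))
      (C := 1) (by fun_prop) zero_le_one (fun x _ => by
        rw [Complex.norm_real, Real.norm_of_nonneg (by positivity), one_mul])
    refine h.re.congr (Eventually.of_forall fun x => ?_)
    simp only [← Complex.ofReal_mul]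
    rfl
  · exact integrableOn_mul_mgf_neg hσ hint (measurable_levyKernel ξ) (by positivity)
      fun x hx => norm_levyKernel_le ξ hx
  · rw [integral_mul_mgf_neg hσ hint (measurable_levyKernel ξ) (C := 2 + |ξ| + 3 * ξ ^ 2)
      (by positivity) fun x hx => norm_levyKernel_le ξ hx,
      integral_withDensity_eq_integral_toReal_smul hwm hwlt]
    have hB : Integrable (fun s : ℝ => (s - 1) / (s + 1)) ρ := by
      refine Integrable.of_bound (Measurable.aestronglyMeasurable (by fun_prop)) 1 ?_
      filter_upwards [hρ] with s hs
      rw [Real.norm_eq_abs, abs_div, abs_of_pos (by linarith : 0 < s + 1),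
        div_le_one (by linarith), abs_le]
      constructor <;> linarith
    have hB' : Integrable (fun s : ℝ => Complex.I * ξ * (((s - 1) / (s + 1) : ℝ) : ℂ)) ρ :=
      hB.ofReal.const_mul _
    rw [← integral_complex_ofReal, ← integral_const_mul,
      ← integral_sub (integrable_nevanlinnaKernel ρ ξ) hB']
    refine integral_congr_ae ?_
    filter_upwards [hρ] with s hs
    rw [hwr s hs, integral_levyKernel_mul_exp ξ hs, nevanlinnaKernel_eq ξ hs, Complex.real_smul]
    ring

theorem tendsto_nevanlinnaKernel_zero (s : ℝ) :
    Tendsto (fun ξ : ℝ => nevanlinnaKernel ξ s) (𝓝[>] 0)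
      (𝓝 (({0} : Set ℝ).indicator (fun _ => (1 : ℂ)) s)) := by
  rcases eq_or_ne s 0 with rfl | hs
  · rw [indicator_of_mem (mem_singleton _)]
    refine tendsto_const_nhds.congr' ?_
    filter_upwards [self_mem_nhdsWithin] with ξ hξ
    have : (ξ : ℂ) ≠ 0 := by exact_mod_cast (ne_of_gt hξ)
    simp [nevanlinnaKernel, this]
  · rw [indicator_of_notMem (by simpa using hs)]
    have hc : ContinuousAt (fun ξ : ℝ => nevanlinnaKernel ξ s) 0 := by
      unfold nevanlinnaKernel
      have : ((0 : ℝ) : ℂ) + Complex.I * s ≠ 0 := by simpa using hs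
      fun_prop (disch := exact this)
    have h := hc.tendsto
    rw [show nevanlinnaKernel 0 s = 0 by simp [nevanlinnaKernel]] at h
    exact h.mono_left nhdsWithin_le_nhds

theorem tendsto_integral_nevanlinnaKernel_zero (m : Measure ℝ) [IsFiniteMeasure m] :
    Tendsto (fun ξ : ℝ => ∫ s, nevanlinnaKernel ξ s ∂m) (𝓝[>] 0) (𝓝 (m.real {0} : ℂ)) := by
  have h : ∫ s, ({0} : Set ℝ).indicator (fun _ => (1 : ℂ)) s ∂m = (m.real {0} : ℂ) := by
    rw [integral_indicator (measurableSet_singleton 0), setIntegral_const, Complex.real_smul,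
      mul_one]
  rw [← h]
  refine tendsto_integral_filter_of_dominated_convergence (fun _ => 2)
    (Eventually.of_forall fun ξ => (measurable_nevanlinnaKernel ξ).aestronglyMeasurable) ?_
    (integrable_const _) (Eventually.of_forall tendsto_nevanlinnaKernel_zero)
  filter_upwards [Ioo_mem_nhdsGT (zero_lt_one' ℝ)] with ξ hξ
  refine Eventually.of_forall fun s => (norm_nevanlinnaKernel_le ξ s).trans ?_
  nlinarith [hξ.1, hξ.2]

/-- Splitting a Nevanlinna integral into the contributions of `(0, ∞)`, `(-∞, 0)` and `0`. -/
theorem integral_nevanlinnaKernel_eq (m : Measure ℝ) [IsFiniteMeasure m] {ξ : ℝ} (hξ : ξ ≠ 0) :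
    ∫ s, nevanlinnaKernel ξ s ∂m = ∫ s in Ioi 0, nevanlinnaKernel ξ s ∂m
      + ∫ s, nevanlinnaKernel (-ξ) s ∂((m.restrict (Iio 0)).map Neg.neg) + m.real {0} := by
  have hi := integrable_nevanlinnaKernel m ξ
  rw [integral_map measurable_neg.aemeasurable
    (measurable_nevanlinnaKernel (-ξ)).aestronglyMeasurable]
  simp only [nevanlinnaKernel_neg_right, neg_neg]
  rw [← integral_add_compl (measurableSet_Ioi (a := (0 : ℝ))) hi, compl_Ioi, ← Iio_union_right,
    setIntegral_union (by simp) (measurableSet_singleton 0) hi.integrableOn hi.integrableOn,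
    integral_singleton, add_assoc]
  have : (ξ : ℂ) ≠ 0 := by exact_mod_cast hξ
  simp [nevanlinnaKernel, this]

theorem CompletelyMonotoneOn.congr {f g : ℝ → ℝ} (hf : CompletelyMonotoneOn f)
    (h : EqOn g f (Ioi 0)) : CompletelyMonotoneOn g := by
  refine ⟨fun n => (hf.1 n).congr h, fun n x hx => ?_⟩
  rw [iteratedDerivWithin_congr h hx]
  exact hf.2 n x hx

theorem integrableOn_compl_zero {E : Type*} [NormedAddCommGroup E] {f : ℝ → E}
    (hp : IntegrableOn f (Ioi 0)) (hn : IntegrableOn (fun x => f (-x)) (Ioi 0)) :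
    IntegrableOn f ({0} : Set ℝ)ᶜ := by
  rw [← Iio_union_Ioi]
  refine IntegrableOn.union ?_ hp
  simpa only [neg_neg] using
    IntegrableOn.comp_neg_Iio (c := (0 : ℝ)) (f := fun x => f (-x)) (by rwa [neg_zero])

theorem setIntegral_compl_zero {E : Type*} [NormedAddCommGroup E] [NormedSpace ℝ E] {f : ℝ → E}
    (hp : IntegrableOn f (Ioi 0)) (hn : IntegrableOn (fun x => f (-x)) (Ioi 0)) :
    ∫ x in ({0} : Set ℝ)ᶜ, f x = (∫ x in Ioi 0, f x) + ∫ x in Ioi 0, f (-x) := by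
  have hi := integrableOn_compl_zero hp hn
  rw [← Iio_union_Ioi] at hi ⊢
  have hd : Disjoint (Iio (0 : ℝ)) (Ioi 0) :=
    Set.disjoint_left.2 fun x (hx : x < 0) (hx' : 0 < x) => lt_asymm hx hx'
  rw [setIntegral_union hd measurableSet_Ioi
    hi.left_of_union hp, integral_comp_neg_Ioi, neg_zero, integral_Iic_eq_integral_Iio, add_comm]

/-- The compensated kernel of the Lévy–Khintchine formula on the real line. -/
def twoSidedLevyKernel (ξ x : ℝ) : ℂ :=
  1 - Complex.exp (Complex.I * (ξ : ℂ) * (x : ℂ))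
    + Complex.I * (ξ : ℂ) * ((1 - Real.exp (-|x|) : ℝ) : ℂ) * (Real.sign x : ℂ)

theorem twoSidedLevyKernel_of_pos (ξ : ℝ) {x : ℝ} (hx : 0 < x) :
    twoSidedLevyKernel ξ x = levyKernel ξ x := by
  simp [twoSidedLevyKernel, levyKernel, Real.sign_of_pos hx, abs_of_pos hx]

theorem twoSidedLevyKernel_neg (ξ x : ℝ) :
    twoSidedLevyKernel ξ (-x) = twoSidedLevyKernel (-ξ) x := by
  simp [twoSidedLevyKernel, Real.sign_neg]

theorem conj_twoSidedLevyKernel (ξ x : ℝ) :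
    starRingEnd ℂ (twoSidedLevyKernel ξ x) = twoSidedLevyKernel (-ξ) x := by
  simp only [twoSidedLevyKernel, map_add, map_sub, map_mul, map_one, ← Complex.exp_conj,
    Complex.conj_I, Complex.conj_ofReal]
  push_cast
  ring_nf

/-- A pair of finite measures on `(0, ∞)` gives rise to a Lévy density on `ℝ ∖ {0}` with
completely monotone halves. -/
theorem exists_twoSided_levyDensity {ρ₁ ρ₂ : Measure ℝ} [IsFiniteMeasure ρ₁] [IsFiniteMeasure ρ₂]
    (h₁ : ∀ᵐ s ∂ρ₁, 0 < s) (h₂ : ∀ᵐ s ∂ρ₂, 0 < s) :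
    ∃ (B : ℝ) (ν : ℝ → ℝ), Measurable ν ∧ (∀ x, 0 ≤ ν x) ∧
      IntegrableOn (fun x : ℝ => min 1 (x ^ 2) * ν x) (({0} : Set ℝ)ᶜ) ∧
      CompletelyMonotoneOn ν ∧ CompletelyMonotoneOn (fun x : ℝ => ν (-x)) ∧
      ∀ ξ : ℝ, IntegrableOn (fun x : ℝ => twoSidedLevyKernel ξ x * (ν x : ℂ)) (({0} : Set ℝ)ᶜ) ∧
        ∫ x in ({0} : Set ℝ)ᶜ, twoSidedLevyKernel ξ x * (ν x : ℂ)
          = ∫ s, nevanlinnaKernel ξ s ∂ρ₁ + ∫ s, nevanlinnaKernel (-ξ) s ∂ρ₂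
            - Complex.I * ξ * (B : ℂ) := by
  obtain ⟨N₁, hm₁, hn₁, hcm₁, hi₁, hk₁⟩ := exists_completelyMonotoneOn_levyDensity h₁
  obtain ⟨N₂, hm₂, hn₂, hcm₂, hi₂, hk₂⟩ := exists_completelyMonotoneOn_levyDensity h₂
  set ν : ℝ → ℝ := fun x => if 0 < x then N₁ x else N₂ (-x) with hν
  have hpos : ∀ x ∈ Ioi (0 : ℝ), ν x = N₁ x := fun x hx => if_pos hx
  have hneg : ∀ x ∈ Ioi (0 : ℝ), ν (-x) = N₂ x := fun x hx => by
    simp only [hν]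
    rw [if_neg (by simpa using le_of_lt hx), neg_neg]
  have hint : ∀ ξ : ℝ,
      IntegrableOn (fun x : ℝ => twoSidedLevyKernel ξ x * (ν x : ℂ)) (Ioi 0) := fun ξ =>
    (hk₁ ξ).1.congr_fun (fun x hx => by
      simp only [twoSidedLevyKernel_of_pos ξ hx, hpos x hx]) measurableSet_Ioi
  have hcongr : ∀ ξ : ℝ, EqOn (fun x : ℝ => levyKernel (-ξ) x * (N₂ x : ℂ))
      (fun x => twoSidedLevyKernel ξ (-x) * (ν (-x) : ℂ)) (Ioi 0) := fun ξ x hx => by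
    simp only [twoSidedLevyKernel_neg, twoSidedLevyKernel_of_pos (-ξ) hx, hneg x hx]
  have hint' : ∀ ξ : ℝ,
      IntegrableOn (fun x : ℝ => twoSidedLevyKernel ξ (-x) * (ν (-x) : ℂ)) (Ioi 0) := fun ξ =>
    (hk₂ (-ξ)).1.congr_fun (hcongr ξ) measurableSet_Ioi
  refine ⟨(∫ s, (s - 1) / (s + 1) ∂ρ₁) - ∫ s, (s - 1) / (s + 1) ∂ρ₂, ν,
    Measurable.ite measurableSet_Ioi hm₁ (hm₂.comp measurable_neg), fun x => ?_, ?_,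
    hcm₁.congr hpos, hcm₂.congr hneg, fun ξ => ⟨integrableOn_compl_zero (hint ξ) (hint' ξ), ?_⟩⟩
  · simp only [hν]
    split_ifs
    exacts [hn₁ x, hn₂ (-x)]
  · refine integrableOn_compl_zero
      (hi₁.congr_fun (fun x hx => ?_) measurableSet_Ioi)
      (hi₂.congr_fun (fun x hx => ?_) measurableSet_Ioi)
    · simp only [hpos x hx]
    · simp only [hneg x hx, neg_sq]
  · rw [setIntegral_compl_zero (hint ξ) (hint' ξ),
      ← setIntegral_congr_fun measurableSet_Ioi (hcongr ξ), (hk₂ (-ξ)).2,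
      setIntegral_congr_fun measurableSet_Ioi
        (g := fun x => levyKernel ξ x * (N₁ x : ℂ)) fun x hx => by
          simp only [twoSidedLevyKernel_of_pos ξ hx, hpos x hx], (hk₁ ξ).2]
    push_cast
    ring

/-- If `Ψ : ℝ → ℂ` is continuous, satisfies `Ψ(−ξ) = conj (Ψ ξ)`, and
extends to a Rogers function, then `Ψ` is the Lévy–Khintchine exponent of a Lévy process
with completely monotone jumps: there are `α, γ ≥ 0`, `β ∈ ℝ` and a nonnegative measurable
Lévy density `ν` on `ℝ ∖ {0}` with `∫ min(1, x²) ν(x) dx < ∞`, with `ν(x)` and `ν(−x)`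
completely monotone on `(0, ∞)`, such that
`Ψ(ξ) = α ξ² − i β ξ + γ + ∫ (1 − e^{iξx} + iξ(1 − e^{−|x|}) sign x) ν(x) dx`. -/
theorem statement5 (Ψ : ℝ → ℂ) (hcont : Continuous Ψ)
    (hsym : ∀ ξ : ℝ, Ψ (-ξ) = starRingEnd ℂ (Ψ ξ))
    (hrog : ExtendsToRogersFunction Ψ) :
    ∃ (α β γ : ℝ) (ν : ℝ → ℝ), 0 ≤ α ∧ 0 ≤ γ ∧
      Measurable ν ∧ (∀ x : ℝ, x ≠ 0 → 0 ≤ ν x) ∧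
      IntegrableOn (fun x : ℝ => min 1 (x ^ 2) * ν x) (({0} : Set ℝ)ᶜ) ∧
      CompletelyMonotoneOn ν ∧
      CompletelyMonotoneOn (fun x : ℝ => ν (-x)) ∧
      ∀ ξ : ℝ,
        IntegrableOn (fun x : ℝ =>
          (1 - Complex.exp (Complex.I * (ξ : ℂ) * (x : ℂ))
            + Complex.I * (ξ : ℂ) * ((1 - Real.exp (-|x|) : ℝ) : ℂ) * (Real.sign x : ℂ))
            * ((ν x : ℝ) : ℂ)) (({0} : Set ℝ)ᶜ) ∧
        Ψ ξ = (α : ℂ) * (ξ : ℂ) ^ 2 - Complex.I * (β : ℂ) * (ξ : ℂ) + (γ : ℂ) +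
          ∫ x in (({0} : Set ℝ)ᶜ),
            (1 - Complex.exp (Complex.I * (ξ : ℂ) * (x : ℂ))
              + Complex.I * (ξ : ℂ) * ((1 - Real.exp (-|x|) : ℝ) : ℂ) * (Real.sign x : ℂ))
              * ((ν x : ℝ) : ℂ) := by
  obtain ⟨F, ⟨hF, hre⟩, hFΨ⟩ := hrog
  have hG : DifferentiableOn ℂ (fun z => F z / z) {z | 0 < z.re} :=
    hF.div differentiableOn_id fun z hz (h : z = 0) => by
      subst h
      simp at hz
  obtain ⟨b, c, m, hc, hm, hrep⟩ := exists_isFiniteMeasure_nevanlinna hG hre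
  have h₁ : ∀ᵐ s ∂(m.restrict (Ioi 0)), 0 < s := ae_restrict_mem measurableSet_Ioi
  have h₂ : ∀ᵐ s ∂((m.restrict (Iio 0)).map Neg.neg), 0 < s := by
    rw [ae_map_iff measurable_neg.aemeasurable measurableSet_Ioi]
    filter_upwards [ae_restrict_mem measurableSet_Iio] with s hs
    simpa using hs
  obtain ⟨B, ν, hνm, hν0, hνi, hcm, hcm', hν⟩ := exists_twoSided_levyDensity h₁ h₂
  have hΨ : ∀ ξ : ℝ, 0 < ξ → Ψ ξ = c * ξ ^ 2 + Complex.I * b * ξ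
      + ∫ s, nevanlinnaKernel ξ s ∂m := by
    intro ξ hξ
    have hξ0 : (ξ : ℂ) ≠ 0 := by exact_mod_cast hξ.ne'
    have h := hrep ξ (by simpa using hξ)
    rw [div_eq_iff hξ0, hFΨ ξ hξ] at h
    unfold nevanlinnaKernel
    rw [h, integral_const_mul]
    ring
  have hΨ0 : Ψ 0 = m.real {0} := by
    have hlim : Tendsto (fun ξ : ℝ => (c : ℂ) * ξ ^ 2 + Complex.I * b * ξ
        + ∫ s, nevanlinnaKernel ξ s ∂m) (𝓝[>] 0) (𝓝 (m.real {0} : ℂ)) := by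
      have hp : Tendsto (fun ξ : ℝ => (c : ℂ) * ξ ^ 2 + Complex.I * b * ξ) (𝓝[>] 0) (𝓝 0) := by
        have : Continuous fun ξ : ℝ => (c : ℂ) * ξ ^ 2 + Complex.I * b * ξ := by fun_prop
        simpa using (this.tendsto 0).mono_left nhdsWithin_le_nhds
      simpa using hp.add (tendsto_integral_nevanlinnaKernel_zero m)
    refine tendsto_nhds_unique ((hcont.tendsto 0).mono_left nhdsWithin_le_nhds)
      (hlim.congr' ?_)
    filter_upwards [self_mem_nhdsWithin] with ξ hξ
    exact (hΨ ξ hξ).symm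
  have hposi : ∀ ξ : ℝ, 0 < ξ → Ψ ξ = (c : ℂ) * (ξ : ℂ) ^ 2
      - Complex.I * ((-(b + B) : ℝ) : ℂ) * (ξ : ℂ) + (m.real {0} : ℂ)
      + ∫ x in ({0} : Set ℝ)ᶜ, twoSidedLevyKernel ξ x * (ν x : ℂ) := by
    intro ξ hξ
    rw [hΨ ξ hξ, (hν ξ).2, integral_nevanlinnaKernel_eq m hξ.ne']
    push_cast
    ring
  refine ⟨c, -(b + B), m.real {0}, ν, hc, measureReal_nonneg, hνm, fun x _ => hν0 x, hνi, hcm,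
    hcm', fun ξ => ⟨(hν ξ).1, ?_⟩⟩
  change Ψ ξ = (c : ℂ) * (ξ : ℂ) ^ 2
      - Complex.I * ((-(b + B) : ℝ) : ℂ) * (ξ : ℂ) + (m.real {0} : ℂ)
      + ∫ x in ({0} : Set ℝ)ᶜ, twoSidedLevyKernel ξ x * (ν x : ℂ)
  rcases lt_trichotomy ξ 0 with hξ | rfl | hξ
  · have h := hsym (-ξ)
    rw [neg_neg] at h
    rw [h, hposi (-ξ) (neg_pos.2 hξ)]
    simp only [map_add, map_sub, map_mul, map_pow, ← integral_conj, conj_twoSidedLevyKernel,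
      Complex.conj_I, Complex.conj_ofReal, neg_neg]
    push_cast
    ring
  · simp [hΨ0, twoSidedLevyKernel]
  · exact hposi ξ hξ
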